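/- Let κ > 0 and σ > 0, and let f(x) = Z^{−1}·(1 + κ·(x/σ)²)^{−(1+κ)/(2κ)} on ℝ be the coupled Gaussian (Student's t) density, where Z = √π·Γ(1/(2κ))·σ/(√κ·Γ((1+κ)/(2κ))). Then the coupled second moment equals the squared scale: ( ∫_{−∞}^∞ x²·f(x)^{(1+3κ)/(1+κ)} dx ) / ( ∫_{−∞}^∞ f(x)^{(1+3κ)/(1+κ)} dx ) = σ². -/

import Mathlib

open MeasureTheory Real

theorem integrable_one_add_sq_rpow_neg {s : ℝ} (hs : 1 / 2 < s) :
    Integrable fun y : ℝ => (1 + y ^ 2) ^ (-s) := by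
  have h := integrable_rpow_neg_one_add_norm_sq (E := ℝ) (μ := volume) (r := 2 * s)
    (by simp; linarith)
  refine h.congr (Filter.Eventually.of_forall fun y => ?_)
  simp only [norm_eq_abs, sq_abs]
  congr 1
  ring

theorem sq_mul_one_add_sq_rpow_neg (s y : ℝ) :
    y ^ 2 * (1 + y ^ 2) ^ (-(s + 1)) = (1 + y ^ 2) ^ (-s) - (1 + y ^ 2) ^ (-(s + 1)) := by
  have hy : 0 < 1 + y ^ 2 := by positivity
  have h : (1 + y ^ 2) ^ (-s) = (1 + y ^ 2) ^ (-(s + 1)) * (1 + y ^ 2) := by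
    rw [← rpow_add_one hy.ne']
    ring_nf
  rw [h]
  ring

theorem integrable_sq_mul_one_add_sq_rpow_neg {s : ℝ} (hs : 1 / 2 < s) :
    Integrable fun y : ℝ => y ^ 2 * (1 + y ^ 2) ^ (-(s + 1)) := by
  simp only [sq_mul_one_add_sq_rpow_neg]
  exact (integrable_one_add_sq_rpow_neg hs).sub (integrable_one_add_sq_rpow_neg (by linarith))

theorem tendsto_mul_one_add_sq_rpow_neg_atTop {s : ℝ} (hs : 1 / 2 < s) :
    Filter.Tendsto (fun y : ℝ => y * (1 + y ^ 2) ^ (-s)) Filter.atTop (nhds 0) := by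
  have hlim := tendsto_rpow_neg_atTop (show 0 < 2 * s - 1 by linarith)
  refine squeeze_zero' ?_ ?_ hlim
  · filter_upwards [Filter.eventually_ge_atTop 0] with y hy
    positivity
  · filter_upwards [Filter.eventually_gt_atTop 0] with y hy
    calc y * (1 + y ^ 2) ^ (-s) ≤ y * (y ^ 2) ^ (-s) := by
          gcongr ?_ * ?_
          exact rpow_le_rpow_of_nonpos (by positivity) (by linarith) (by linarith)
      _ = y ^ (-(2 * s - 1)) := by
          rw [← rpow_natCast, ← rpow_mul hy.le, mul_comm, ← rpow_add_one hy.ne']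
          congr 1
          push_cast
          ring

theorem tendsto_mul_one_add_sq_rpow_neg_atBot {s : ℝ} (hs : 1 / 2 < s) :
    Filter.Tendsto (fun y : ℝ => y * (1 + y ^ 2) ^ (-s)) Filter.atBot (nhds 0) := by
  have h := ((tendsto_mul_one_add_sq_rpow_neg_atTop hs).comp Filter.tendsto_neg_atBot_atTop).neg
  simpa [Function.comp_def] using h

theorem hasDerivAt_mul_one_add_sq_rpow_neg (s y : ℝ) :
    HasDerivAt (fun y : ℝ => y * (1 + y ^ 2) ^ (-s))
      ((1 + y ^ 2) ^ (-(s + 1)) - (2 * s - 1) * (y ^ 2 * (1 + y ^ 2) ^ (-(s + 1)))) y := by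
  have hy : 0 < 1 + y ^ 2 := by positivity
  have hd : HasDerivAt (fun y : ℝ => 1 + y ^ 2) (2 * y) y := by
    simpa using (hasDerivAt_pow 2 y).const_add 1
  refine ((hasDerivAt_id' y).mul (hd.rpow_const (p := -s) (Or.inl hy.ne'))).congr_deriv ?_
  have h := sq_mul_one_add_sq_rpow_neg s y
  rw [show -s - 1 = -(s + 1) by ring]
  linear_combination -h

theorem integral_sq_mul_one_add_sq_rpow_neg {s : ℝ} (hs : 1 / 2 < s) :
    (2 * s - 1) * ∫ y : ℝ, y ^ 2 * (1 + y ^ 2) ^ (-(s + 1)) =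
      ∫ y : ℝ, (1 + y ^ 2) ^ (-(s + 1)) := by
  have hi := integrable_one_add_sq_rpow_neg (s := s + 1) (by linarith)
  have hi' := (integrable_sq_mul_one_add_sq_rpow_neg hs).const_mul (2 * s - 1)
  have h := integral_of_hasDerivAt_of_tendsto (hasDerivAt_mul_one_add_sq_rpow_neg s)
    (hi.sub hi') (tendsto_mul_one_add_sq_rpow_neg_atBot hs)
    (tendsto_mul_one_add_sq_rpow_neg_atTop hs)
  rw [integral_sub hi hi', integral_const_mul] at h
  linarith

theorem integral_one_add_sq_rpow_neg_pos {s : ℝ} (hs : 1 / 2 < s) :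
    0 < ∫ y : ℝ, (1 + y ^ 2) ^ (-s) := by
  have hpos (y : ℝ) : 0 < (1 + y ^ 2) ^ (-s) := by positivity
  rw [integral_pos_iff_support_of_nonneg (fun y => (hpos y).le)
    (integrable_one_add_sq_rpow_neg hs)]
  simp [Function.support_eq_univ fun y => (hpos y).ne']

/-- For the coupled Gaussian (Student's t) density, the coupled (escort) second moment
equals the squared scale:
`(∫ x²·f(x)^{(1+3κ)/(1+κ)} dx) / (∫ f(x)^{(1+3κ)/(1+κ)} dx) = σ²`. -/
theorem coupledGaussian_coupled_second_moment (κ σ : ℝ) (hκ : 0 < κ) (hσ : 0 < σ)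
    (Z : ℝ)
    (hZ : Z = Real.sqrt Real.pi * Real.Gamma (1 / (2 * κ)) * σ /
        (Real.sqrt κ * Real.Gamma ((1 + κ) / (2 * κ))))
    (f : ℝ → ℝ)
    (hf : f = fun x => Z⁻¹ * (1 + κ * (x / σ) ^ 2) ^ (-(1 + κ) / (2 * κ))) :
    (∫ x, x ^ 2 * f x ^ ((1 + 3 * κ) / (1 + κ))) /
        (∫ x, f x ^ ((1 + 3 * κ) / (1 + κ))) = σ ^ 2 := by
  have hs : 1 / 2 < (1 + κ) / (2 * κ) := by
    rw [div_lt_div_iff₀ (by norm_num) (by positivity)]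
    linarith
  have hZ0 : 0 < Z := by
    have h₁ : 0 < Gamma (1 / (2 * κ)) := Gamma_pos_of_pos (by positivity)
    have h₂ : 0 < Gamma ((1 + κ) / (2 * κ)) := Gamma_pos_of_pos (by positivity)
    rw [hZ]
    positivity
  set s := (1 + κ) / (2 * κ) with hs_def
  set p := (1 + 3 * κ) / (1 + κ) with hp_def
  set a := √κ / σ with ha_def
  have ha : 0 < a := by positivity
  have ha2 : a ^ 2 = κ / σ ^ 2 := by rw [ha_def, div_pow, sq_sqrt hκ.le]
  have hfp (x : ℝ) : f x ^ p = Z⁻¹ ^ p * (1 + (a * x) ^ 2) ^ (-(s + 1)) := by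
    have hx : κ * (x / σ) ^ 2 = (a * x) ^ 2 := by
      rw [mul_pow, ha2]
      ring
    have hexp : -(1 + κ) / (2 * κ) * p = -(s + 1) := by
      rw [hp_def, hs_def]
      field_simp
      ring
    simp only [hf]
    rw [hx, mul_rpow (by positivity) (by positivity), ← rpow_mul (by positivity), hexp]
  have hxfp (x : ℝ) : x ^ 2 * f x ^ p =
      Z⁻¹ ^ p * (a ^ 2)⁻¹ * ((a * x) ^ 2 * (1 + (a * x) ^ 2) ^ (-(s + 1))) := by
    rw [hfp]
    field_simp
  simp only [hxfp]
  simp only [hfp, integral_const_mul]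
  rw [Measure.integral_comp_mul_left (fun y : ℝ => y ^ 2 * (1 + y ^ 2) ^ (-(s + 1))) a,
    Measure.integral_comp_mul_left (fun y : ℝ => (1 + y ^ 2) ^ (-(s + 1))) a,
    ← integral_sq_mul_one_add_sq_rpow_neg hs]
  have hpos := integral_one_add_sq_rpow_neg_pos (s := s + 1) (by linarith)
  rw [← integral_sq_mul_one_add_sq_rpow_neg hs] at hpos
  have hI := right_ne_zero_of_mul hpos.ne'
  have hs' : 2 * s - 1 = κ⁻¹ := by
    rw [hs_def]
    field_simp
    ring
  have hZp : Z⁻¹ ^ p ≠ 0 := by positivity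
  have ha' : |a⁻¹| ≠ 0 := by positivity
  rw [hs', ha2, smul_eq_mul, smul_eq_mul]
  field_simp
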